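/- Suppose (G_n) satisfies Assumption 1 and let T_k = k·T_mix(G_n) and Υ_n = T_mix(G_n)/|V_n|. There exist constants γ > 0, p_0 > 0 and C > 0 such that for all n, all integers k ≥ 1 with k·Υ_n ≤ p_0, all c ≥ 2, and all x, y, z ∈ V_n with x ≠ y, the lazy random walk X started at x satisfies | P_x[ X(c·T_k) = z | τ(y) ≥ c·T_k ] − π(z;G_n) | ≤ C ( e^{−γck} + k·Υ_n + g(y,z;G_n) ) · π(z;G_n). -/

import Mathlib

open MeasureTheory ProbabilityTheory Filter

attribute [local instance] Classical.propDecidable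

noncomputable section

namespace RWPaint

variable {V : Type*} [Fintype V]

/-- The degree of a vertex. -/
def deg (G : SimpleGraph V) (x : V) : ℕ := (Finset.univ.filter fun y => G.Adj x y).card

/-- One-step transition kernel of the lazy random walk on a finite graph:
holding probability `1/2`, otherwise a uniformly chosen neighbour. -/
def K (G : SimpleGraph V) (x y : V) : ℝ :=
  if x = y then (if deg G x = 0 then 1 else 1 / 2)
  else if G.Adj x y then 1 / (2 * (deg G x : ℝ)) else 0

/-- The `t`-step transition kernel. -/
def Kpow (G : SimpleGraph V) : ℕ → V → V → ℝ
  | 0 => fun x y => if x = y then 1 else 0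
  | t + 1 => fun x y => ∑ z, Kpow G t x z * K G z y

/-- The uniform (stationary) probability of a single vertex. -/
def unif (V : Type*) [Fintype V] : ℝ := (Fintype.card V : ℝ)⁻¹

/-- The uniform mixing time. -/
def Tmix (G : SimpleGraph V) : ℕ :=
  sInf {t : ℕ | ∀ x y : V, |Kpow G t x y / unif V - 1| ≤ 1 / 4}

/-- The Green's function `g(x,y) = ∑_{t=0}^{Tmix} p^t(x,y)`. -/
def green (G : SimpleGraph V) (x y : V) : ℝ :=
  ∑ t ∈ Finset.range (Tmix G + 1), Kpow G t x y

/-- The kernel killed on (entering) the set `S`. -/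
def Kkill (G : SimpleGraph V) (S : Finset V) (x y : V) : ℝ :=
  if y ∈ S then 0 else K G x y

/-- Powers of the killed kernel. -/
def KkillPow (G : SimpleGraph V) (S : Finset V) : ℕ → V → V → ℝ
  | 0 => fun x y => if x = y then 1 else 0
  | t + 1 => fun x y => ∑ z, KkillPow G S t x z * Kkill G S z y

/-- `P_x[τ(S) ≤ T]`, the probability that the lazy walk started at `x` visits `S`
by time `T`. -/
def hitBy (G : SimpleGraph V) (S : Finset V) (x : V) (T : ℕ) : ℝ :=
  if x ∈ S then 1 else 1 - ∑ z, KkillPow G S T x z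

/-- `f_{n,c}(x,y) = P_x[τ(y) ≤ c T_mix]`. -/
def fnc (G : SimpleGraph V) (c : ℝ) (x y : V) : ℝ :=
  hitBy G {y} x ⌊c * (Tmix G : ℝ)⌋₊

/-- `f̄_{n,c} = ∑_y f_{n,c}(x,y) π(y)` (averaged also over `x`; by vertex
transitivity this agrees with the value for any fixed `x`). -/
def fbar (G : SimpleGraph V) (c : ℝ) : ℝ :=
  (∑ x : V, ∑ y : V, fnc G c x y) / (Fintype.card V : ℝ) ^ 2

/-- `F_{n,c} = ∑_{x,y} (f_{n,c}(x,y) - f̄_{n,c})^2`. -/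
def Fquad (G : SimpleGraph V) (c : ℝ) : ℝ :=
  ∑ x : V, ∑ y : V, (fnc G c x y - fbar G c) ^ 2

/-- `Γ_n = c₀ T_mix log |V|`. -/
def gammaTime (G : SimpleGraph V) (c₀ : ℝ) : ℕ :=
  ⌊c₀ * (Tmix G : ℝ) * Real.log (Fintype.card V)⌋₊

/-- `P_x[X_t = z | τ(y) ≥ t]` as a combinatorial formula (meaningful for
`x ≠ y` and `t ≥ 1`). -/
def condAtProb (G : SimpleGraph V) (y x z : V) (t : ℕ) : ℝ :=
  (∑ w, KkillPow G {y} (t - 1) x w * K G w z) / (∑ w, KkillPow G {y} (t - 1) x w)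

/-- `∑_{t=0}^{c T_mix} p^t(x,y)`. -/
def greenC (G : SimpleGraph V) (c : ℝ) (x y : V) : ℝ :=
  ∑ t ∈ Finset.range (⌊c * (Tmix G : ℝ)⌋₊ + 1), Kpow G t x y

/-- A graph is vertex transitive if its automorphism group acts transitively. -/
def IsVertexTransitive (G : SimpleGraph V) : Prop :=
  ∀ x y : V, ∃ e : G ≃g G, e x = y

/-- The probability of a trajectory prefix for the lazy walk with initial
distribution `init`. -/
def walkP (G : SimpleGraph V) (init : V → ℝ) (n : ℕ) (v : ℕ → V) : ℝ :=
  init (v 0) * ∏ i ∈ Finset.range n, K G (v i) (v (i + 1))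

/-- Point mass initial distribution. -/
def delta (x : V) : V → ℝ := fun y => if y = x then 1 else 0

/-- Uniform initial distribution. -/
def uinit (V : Type*) [Fintype V] : V → ℝ := fun _ => (Fintype.card V : ℝ)⁻¹

/-- `X₁, X₂` are independent lazy random walks on `G` with initial
distributions `init₁, init₂`, defined on the probability space `(Ω, P)`:
all finite-dimensional distributions factorize as products of trajectory-prefix
probabilities. -/
structure IsWalkPair {Ω : Type*} [MeasurableSpace Ω] (G : SimpleGraph V) (P : Measure Ω)
    (X₁ X₂ : ℕ → Ω → V) (init₁ init₂ : V → ℝ) : Prop where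
  meas₁ : ∀ (t : ℕ) (x : V), MeasurableSet {ω | X₁ t ω = x}
  meas₂ : ∀ (t : ℕ) (x : V), MeasurableSet {ω | X₂ t ω = x}
  law : ∀ (n : ℕ) (v w : ℕ → V),
    (P {ω | (∀ i ≤ n, X₁ i ω = v i) ∧ ∀ i ≤ n, X₂ i ω = w i}).toReal
      = walkP G init₁ n v * walkP G init₂ n w

/-- `X₁, X₂` are independent stationary lazy random walks on `G`, together with
a family `ξ` of independent fair coins (one per vertex, used to break ties),
all defined on the probability space `(Ω, P)`. -/
structure IsPaintSetup {Ω : Type*} [MeasurableSpace Ω] (G : SimpleGraph V) (P : Measure Ω)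
    (X₁ X₂ : ℕ → Ω → V) (ξ : V → Ω → Bool) : Prop where
  meas₁ : ∀ (t : ℕ) (x : V), MeasurableSet {ω | X₁ t ω = x}
  meas₂ : ∀ (t : ℕ) (x : V), MeasurableSet {ω | X₂ t ω = x}
  measξ : ∀ x : V, MeasurableSet {ω | ξ x ω = true}
  law : ∀ (n : ℕ) (v w : ℕ → V) (b : V → Bool),
    (P {ω | ((∀ i ≤ n, X₁ i ω = v i) ∧ ∀ i ≤ n, X₂ i ω = w i) ∧ ∀ x, ξ x ω = b x}).toReal
      = walkP G (uinit V) n v * walkP G (uinit V) n w * (1 / 2) ^ Fintype.card V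

/-- The hitting time `τ(x)` of a vertex `x` (with value `⊤` if `x` is never visited). -/
def hitTime {Ω : Type*} (X : ℕ → Ω → V) (x : V) (ω : Ω) : ℕ∞ :=
  ⨅ (s : ℕ) (_ : X s ω = x), (s : ℕ∞)

/-- `τ(x,y) = τ(x) ⊓ τ(y)`. -/
def hitTime2 {Ω : Type*} (X : ℕ → Ω → V) (x y : V) (ω : Ω) : ℕ∞ :=
  min (hitTime X x ω) (hitTime X y ω)

/-- `|𝒜₁|`: the number of vertices first visited by `X₁` (ties broken by the coins `ξ`). -/
def paintedCount {Ω : Type*} (X₁ X₂ : ℕ → Ω → V) (ξ : V → Ω → Bool) (ω : Ω) : ℕ :=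
  Nat.card {x : V // hitTime X₁ x ω < hitTime X₂ x ω ∨
    (hitTime X₁ x ω = hitTime X₂ x ω ∧ ξ x ω = true)}

/-- The event `H(x,y) = {τ₁(x) < min(τ₁(y), τ₂(x), τ₂(y))}`. -/
def Hevent {Ω : Type*} (X₁ X₂ : ℕ → Ω → V) (x y : V) : Set Ω :=
  {ω | hitTime X₁ x ω < min (hitTime X₁ y ω) (min (hitTime X₂ x ω) (hitTime X₂ y ω))}

/-- `Y₂ = X₂(τ₁(x,y))`. -/
def Ytwo {Ω : Type*} (X₁ X₂ : ℕ → Ω → V) (x y : V) (ω : Ω) : V :=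
  X₂ (hitTime2 X₁ x y ω).toNat ω

/-- `π̃(z;x,y) = P[X₂(τ₁(x,y)) = z | H(x,y)]`. -/
def pitilde {Ω : Type*} [MeasurableSpace Ω] (P : Measure Ω) (X₁ X₂ : ℕ → Ω → V) (x y z : V) : ℝ :=
  (P (Hevent X₁ X₂ x y ∩ {ω | Ytwo X₁ X₂ x y ω = z})).toReal
    / (P (Hevent X₁ X₂ x y)).toReal

/-- The event `A(x,y) = {τ₁(x,y) ≥ τ₂(x,y) > τ₁(x,y) - Γ, τ₁(x) < τ₁(y)}`. -/
def Aevent {Ω : Type*} (X₁ X₂ : ℕ → Ω → V) (x y : V) (Γ : ℕ) : Set Ω :=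
  {ω | hitTime2 X₂ x y ω ≤ hitTime2 X₁ x y ω ∧
    hitTime2 X₁ x y ω - (Γ : ℕ∞) < hitTime2 X₂ x y ω ∧
    hitTime X₁ x ω < hitTime X₁ y ω}

/-- Conditional probability `P[A | B]`. -/
def condGiven {Ω : Type*} [MeasurableSpace Ω] (P : Measure Ω) (A B : Set Ω) : ℝ :=
  (P (A ∩ B)).toReal / (P B).toReal

/-- Assumption 1 of the paper. -/
structure Assumption1 (V : ℕ → Type*) [∀ n, Fintype (V n)]
    (G : ∀ n, SimpleGraph (V n)) : Prop where
  conn : ∀ n, (G n).Connected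
  vt : ∀ n, IsVertexTransitive (G n)
  card_top : Tendsto (fun n => Fintype.card (V n)) atTop atTop
  tmix_small : Tendsto (fun n =>
    (Tmix (G n) : ℝ) * (Real.log (Fintype.card (V n))) ^ 2 / (Fintype.card (V n) : ℝ))
    atTop (nhds 0)
  tmix_top : Tendsto (fun n => Tmix (G n)) atTop atTop
  green_sq_small : ∃ ε : ℕ → ℝ, Tendsto ε atTop (nhds 0) ∧
    ∀ n, ∀ x : V n, ∑ y ∈ Finset.univ.erase x, (green (G n) x y) ^ 2
      ≤ ε n * (Tmix (G n) : ℝ) / Real.log (Fintype.card (V n))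
  hit_miss : ∃ ρ : ℝ, ρ < 1 ∧ ∀ n, ∀ x y z : V n, x ≠ y → x ≠ z → y ≠ z →
    hitBy (G n) {y, z} x (Tmix (G n)) ≤ ρ

/-- The discrete torus `ℤ_n^d`. -/
def torus (d n : ℕ) : SimpleGraph (Fin d → ZMod n) where
  Adj x y := x ≠ y ∧ ∃ i, y - x = Pi.single i 1 ∨ x - y = Pi.single i 1
  symm := by
    constructor
    rintro x y ⟨hne, i, h | h⟩
    · exact ⟨hne.symm, i, Or.inr h⟩
    · exact ⟨hne.symm, i, Or.inl h⟩
  loopless := ⟨fun x h => h.1 rfl⟩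

/-- The hypercube `ℤ_2^n`. -/
def hypercube (n : ℕ) : SimpleGraph (Fin n → Bool) where
  Adj x y := x ≠ y ∧ ∃ i, ∀ j, j ≠ i → x j = y j
  symm := by
    constructor
    rintro x y ⟨hne, i, h⟩
    exact ⟨hne.symm, i, fun j hj => (h j hj).symm⟩
  loopless := ⟨fun x h => h.1 rfl⟩

/-- The Cayley graph of the symmetric group `S_n` generated by the transpositions. -/
def transpositionGraph (n : ℕ) : SimpleGraph (Equiv.Perm (Fin n)) where
  Adj σ τ := (σ * τ⁻¹).IsSwap
  symm := by
    constructor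
    rintro σ τ ⟨a, b, hab, h⟩
    exact ⟨a, b, hab, by rw [show τ * σ⁻¹ = (σ * τ⁻¹)⁻¹ by group, h, Equiv.swap_inv]⟩
  loopless := by
    constructor
    intro σ h
    obtain ⟨a, b, hab, h⟩ := h
    rw [mul_inv_cancel] at h
    exact hab (by simpa [Equiv.swap_apply_left] using Equiv.ext_iff.mp h a)

/-- One-step kernel of the lazy simple random walk on `ℤ^d`. -/
def KZ (d : ℕ) (x y : Fin d → ℤ) : ℝ :=
  if x = y then 1 / 2
  else if ∃ i, y - x = Pi.single i 1 ∨ x - y = Pi.single i 1 then 1 / (4 * d) else 0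

/-- `t`-step kernel of the lazy simple random walk on `ℤ^d`. -/
def KZpow (d : ℕ) : ℕ → (Fin d → ℤ) → (Fin d → ℤ) → ℝ
  | 0 => fun x y => if x = y then 1 else 0
  | t + 1 => fun x y => ∑' z, KZpow d t x z * KZ d z y

/-- The Green's function `G(x; ℤ^d) = ∑_{t=0}^∞ p^t(0,x)` of the lazy walk on `ℤ^d`. -/
def greenZ (d : ℕ) (x : Fin d → ℤ) : ℝ := ∑' t : ℕ, KZpow d t 0 x

/-- `α_d` for `d ≥ 5`. -/
def alphaHigh (d : ℕ) : ℝ := (∑' y : Fin d → ℤ, (greenZ d y) ^ 2) / (greenZ d 0) ^ 2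

/-- The normalization `h_d(n)`. -/
def hfun (d n : ℕ) : ℝ :=
  if d = 3 then (n : ℝ) ^ 4
  else if d = 4 then (n : ℝ) ^ 4 * Real.log n
  else (n : ℝ) ^ d

/-- Matrix powers of an abstract kernel. -/
def mpow (p : V → V → ℝ) : ℕ → V → V → ℝ
  | 0 => fun x y => if x = y then 1 else 0
  | t + 1 => fun x y => ∑ z, mpow p t x z * p z y

/-- Total variation distance between two (probability) vectors. -/
def tvDist (μ ν : V → ℝ) : ℝ := (1 / 2) * ∑ x, |μ x - ν x|


lemma aux_pow_nonneg (P : Matrix V V ℝ) (h0 : ∀ x y, 0 ≤ P x y) (t : ℕ) :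
    ∀ x y, 0 ≤ (P ^ t) x y := by
  induction t with
  | zero => intro x y; rw [pow_zero, Matrix.one_apply]; split_ifs <;> norm_num
  | succ t ih =>
    intro x y
    rw [pow_succ, Matrix.mul_apply]
    exact Finset.sum_nonneg fun w _ => mul_nonneg (ih _ _) (h0 _ _)

lemma aux_mul_row (A P : Matrix V V ℝ) (h1 : ∀ x, ∑ y, P x y = 1) (x : V) :
    ∑ z, (A * P) x z = ∑ z, A x z := by
  simp only [Matrix.mul_apply]
  rw [Finset.sum_comm]
  refine Finset.sum_congr rfl fun w _ => ?_
  rw [← Finset.mul_sum, h1, mul_one]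

lemma aux_mul_col (A P : Matrix V V ℝ) (h1 : ∀ y, ∑ x, P x y = 1) (z : V) :
    ∑ x, (P * A) x z = ∑ x, A x z := by
  simp only [Matrix.mul_apply]
  rw [Finset.sum_comm]
  refine Finset.sum_congr rfl fun w _ => ?_
  rw [← Finset.sum_mul, h1, one_mul]

lemma aux_pow_row (P : Matrix V V ℝ) (h1 : ∀ x, ∑ y, P x y = 1) (t : ℕ) :
    ∀ x, ∑ y, (P ^ t) x y = 1 := by
  induction t with
  | zero => intro x; simp [Matrix.one_apply]
  | succ t ih => intro x; rw [pow_succ, aux_mul_row _ _ h1, ih]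

lemma aux_pow_col (P : Matrix V V ℝ) (h1 : ∀ y, ∑ x, P x y = 1) (t : ℕ) :
    ∀ y, ∑ x, (P ^ t) x y = 1 := by
  induction t with
  | zero => intro x; simp [Matrix.one_apply]
  | succ t ih => intro x; rw [pow_succ', aux_mul_col _ _ h1, ih]

/-- averaging -/
lemma aux_avg (f : V → ℝ) (u : V → ℝ) (m p B : ℝ) (hu : ∀ x, 0 ≤ u x) (hm : ∑ x, u x = m)
    (hf : ∀ x, |f x - p| ≤ B) : |∑ x, u x * f x - m * p| ≤ m * B := by
  rw [← hm, Finset.sum_mul, Finset.sum_mul, ← Finset.sum_sub_distrib]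
  refine (Finset.abs_sum_le_sum_abs _ _).trans (Finset.sum_le_sum fun x _ => ?_)
  rw [← mul_sub, abs_mul, abs_of_nonneg (hu x)]
  exact mul_le_mul_of_nonneg_left (hf x) (hu x)

lemma aux_decay (P : Matrix V V ℝ) (h0 : ∀ x y, 0 ≤ P x y) (hr : ∀ x, ∑ y, P x y = 1)
    (hc : ∀ y, ∑ x, P x y = 1) (p : ℝ) (hp : 0 < p) (hpn : (Fintype.card V : ℝ) * p = 1) (T : ℕ)
    (hT : ∀ x z, |(P ^ T) x z - p| ≤ p / 4) (j r : ℕ) :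
    ∀ x z, |(P ^ ((j + 1) * T + r)) x z - p| ≤ (1 / 4) ^ (j + 1) * p := by
  have key : ∀ x z, |(P ^ ((j + 1) * T)) x z - p| ≤ (1 / 4) ^ (j + 1) * p := by
    induction j with
    | zero => intro x z; have := hT x z; norm_num at this ⊢; linarith
    | succ j ih =>
      intro x z
      have e : (P ^ ((j + 1 + 1) * T)) x z - p
          = ∑ w, ((P ^ T) x w - p) * ((P ^ ((j + 1) * T)) w z - p) := by
        rw [show (j + 1 + 1) * T = T + (j + 1) * T by ring, pow_add, Matrix.mul_apply]
        have a := aux_pow_row P hr T x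
        have b := aux_pow_col P hc ((j + 1) * T) z
        simp only [sub_mul, mul_sub, Finset.sum_sub_distrib, ← Finset.mul_sum, ← Finset.sum_mul]
        rw [a, b]
        simp only [Finset.sum_const, Finset.card_univ, nsmul_eq_mul]
        linear_combination (-p) * hpn
      rw [e]
      refine (Finset.abs_sum_le_sum_abs _ _).trans ?_
      calc ∑ w, |((P ^ T) x w - p) * ((P ^ ((j + 1) * T)) w z - p)|
          ≤ ∑ w : V, (p / 4) * ((1 / 4) ^ (j + 1) * p) := by
            refine Finset.sum_le_sum fun w _ => ?_
            rw [abs_mul]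
            exact mul_le_mul (hT x w) (ih w z) (abs_nonneg _) (by positivity)
        _ = (1 / 4) ^ (j + 1 + 1) * p := by
            simp only [Finset.sum_const, Finset.card_univ, nsmul_eq_mul]
            rw [pow_succ (1 / 4 : ℝ) (j + 1)]
            linear_combination ((1 / 4) ^ (j + 1) * p / 4) * hpn
  intro x z
  rw [add_comm, pow_add, Matrix.mul_apply]
  have := aux_avg (fun w => (P ^ ((j + 1) * T)) w z) (fun w => (P ^ r) x w) 1 p _
    (aux_pow_nonneg P h0 r x) (aux_pow_row P hr r x) (fun w => key w z)
  simpa using this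

lemma aux_esum (P : Matrix V V ℝ) (h0 : ∀ x y, 0 ≤ P x y) (hr : ∀ x, ∑ y, P x y = 1)
    (hc : ∀ y, ∑ x, P x y = 1) (p : ℝ) (hp : 0 < p) (hpn : (Fintype.card V : ℝ) * p = 1) (T : ℕ)
    (hT1 : 1 ≤ T)
    (hT : ∀ x z, |(P ^ T) x z - p| ≤ p / 4) (y z : V) (R : ℕ) :
    ∑ r ∈ Finset.range R, |(P ^ r) y z - p|
      ≤ ∑ r ∈ Finset.range (T + 1), (P ^ r) y z + 2 * (T * p) := by
  have key : ∀ J : ℕ, ∑ r ∈ Finset.range ((J + 1) * T), |(P ^ r) y z - p|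
      ≤ ∑ r ∈ Finset.range (T + 1), (P ^ r) y z + 2 * (T * p) - T * p * (1 / 4) ^ J := by
    intro J
    induction J with
    | zero =>
      have : ∑ r ∈ Finset.range ((0 + 1) * T), |(P ^ r) y z - p|
          ≤ ∑ r ∈ Finset.range T, ((P ^ r) y z + p) := by
        rw [zero_add, one_mul]
        refine Finset.sum_le_sum fun r _ => ?_
        have := aux_pow_nonneg P h0 r y z
        rw [abs_le]; constructor <;> linarith
      rw [Finset.sum_add_distrib] at this
      rw [Finset.sum_range_succ]
      have h2 := aux_pow_nonneg P h0 T y z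
      simp at this ⊢
      linarith
    | succ J ih =>
      rw [show (J + 1 + 1) * T = (J + 1) * T + T by ring, Finset.sum_range_add]
      have : ∑ i ∈ Finset.range T, |(P ^ ((J + 1) * T + i)) y z - p|
          ≤ ∑ i ∈ Finset.range T, (1 / 4) ^ (J + 1) * p :=
        Finset.sum_le_sum fun i _ => aux_decay P h0 hr hc p hp hpn T hT J i y z
      rw [Finset.sum_const, Finset.card_range, nsmul_eq_mul] at this
      have h3 : 0 ≤ T * p * (1 / 4 : ℝ) ^ J := by positivity
      rw [pow_succ] at this ⊢
      nlinarith
  have h1 : ∑ r ∈ Finset.range R, |(P ^ r) y z - p|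
      ≤ ∑ r ∈ Finset.range ((R + 1) * T), |(P ^ r) y z - p| := by
    refine Finset.sum_le_sum_of_subset_of_nonneg ?_ fun _ _ _ => abs_nonneg _
    refine Finset.range_subset_range.2 ?_
    nlinarith
  have h3 : 0 ≤ T * p * (1 / 4 : ℝ) ^ R := by positivity
  linarith [key R]

lemma aux_decomp (P Q : Matrix V V ℝ) (y : V)
    (hQ : ∀ w v, Q w v = if v = y then 0 else P w v) (l : ℕ) :
    ∀ x z, (P ^ (l + 1)) x z = (Q ^ l * P) x z
      + ∑ s ∈ Finset.range l, (Q ^ s * P) x y * (P ^ (l - s)) y z := by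
  have hQP : ∀ w z, (Q * P) w z = (P * P) w z - P w y * P y z := by
    intro w z
    simp only [Matrix.mul_apply]
    rw [← Finset.add_sum_erase _ _ (Finset.mem_univ y),
      ← Finset.add_sum_erase _ (fun j => P w j * P j z) (Finset.mem_univ y)]
    rw [hQ w y, if_pos rfl]
    have : ∑ v ∈ Finset.univ.erase y, Q w v * P v z = ∑ v ∈ Finset.univ.erase y, P w v * P v z := by
      refine Finset.sum_congr rfl fun v hv => ?_
      rw [hQ, if_neg (Finset.ne_of_mem_erase hv)]
    rw [this]; ring
  induction l with
  | zero => intro x z; simp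
  | succ l ih =>
    intro x z
    have e1 : (Q ^ (l + 1) * P) x z = (Q ^ l * P * P) x z - (Q ^ l * P) x y * P y z := by
      rw [pow_succ, Matrix.mul_assoc, Matrix.mul_assoc, Matrix.mul_apply, Matrix.mul_apply,
        Matrix.mul_apply, Finset.sum_mul, ← Finset.sum_sub_distrib]
      refine Finset.sum_congr rfl fun w _ => ?_
      rw [hQP]; ring
    have e2 : (P ^ (l + 1 + 1)) x z = (Q ^ l * P * P) x z
      + ∑ s ∈ Finset.range l, (Q ^ s * P) x y * (P ^ (l + 1 - s)) y z := by
      rw [pow_succ, Matrix.mul_apply]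
      simp only [ih, add_mul, Finset.sum_add_distrib]
      rw [← Matrix.mul_apply]
      congr 1
      simp only [Finset.sum_mul]
      rw [Finset.sum_comm]
      refine Finset.sum_congr rfl fun s hs => ?_
      have : l + 1 - s = (l - s) + 1 := by have := Finset.mem_range.1 hs; omega
      rw [this, pow_succ, Matrix.mul_apply (M := P ^ (l - s)), Finset.mul_sum]
      refine Finset.sum_congr rfl fun w _ => ?_
      ring
    rw [e1, e2, Finset.sum_range_succ]
    simp
    
lemma aux_main (P Q : Matrix V V ℝ) (y : V)
    (hQ : ∀ w v, Q w v = if v = y then 0 else P w v)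
    (h0 : ∀ x y, 0 ≤ P x y) (hr : ∀ x, ∑ y, P x y = 1)
    (hc : ∀ y, ∑ x, P x y = 1) (p : ℝ) (hp : 0 < p) (hpn : (Fintype.card V : ℝ) * p = 1) (T : ℕ)
    (hT1 : 1 ≤ T)
    (hT : ∀ x z, |(P ^ T) x z - p| ≤ p / 4) (δ : ℝ)
    (hδ : ∀ x, x ≠ y → δ ≤ ∑ z, (Q ^ T) x z)
    (ν : V → ℝ) (hν : ∀ x, 0 ≤ ν x) (hνy : ν y = 0) (m : ℝ) (hm : ∑ x, ν x = m)
    (l : ℕ) (hl : 2 * T ≤ l + 1) (hl2 : 2 * l * p ≤ δ / 2) :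
    m * δ / 2 ≤ ∑ z, ∑ x, ν x * (Q ^ l) x z ∧
    ∀ z, |∑ x, ν x * (Q ^ l * P) x z - p * ∑ z, ∑ x, ν x * (Q ^ l) x z|
      ≤ m * p * (5 * (1 / 4) ^ ((l + 1) / T) + 4 * (T * p)
        + 2 * ∑ r ∈ Finset.range (T + 1), (P ^ r) y z) := by
  have hm0 : 0 ≤ m := hm ▸ Finset.sum_nonneg fun x _ => hν x
  have hQ0 : ∀ x y, 0 ≤ Q x y := by
    intro x v; rw [hQ]; split_ifs; exacts [le_rfl, h0 _ _]
  have hQP0 : ∀ s x z, 0 ≤ (Q ^ s * P) x z := by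
    intro s x z
    rw [Matrix.mul_apply]
    exact Finset.sum_nonneg fun w _ => mul_nonneg (aux_pow_nonneg Q hQ0 s _ _) (h0 _ _)
  set H : ℕ → ℝ := fun s => ∑ x, ν x * (Q ^ s * P) x y with hH
  have hH0 : ∀ s, 0 ≤ H s := fun s => Finset.sum_nonneg fun x _ => mul_nonneg (hν x) (hQP0 _ _ _)
  -- decomposition
  have dec : ∀ l z, ∑ x, ν x * (P ^ (l + 1)) x z = ∑ x, ν x * (Q ^ l * P) x z
      + ∑ s ∈ Finset.range l, H s * (P ^ (l - s)) y z := by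
    intro l z
    simp only [aux_decomp P Q y hQ l, mul_add, Finset.sum_add_distrib, hH]
    congr 1
    simp only [Finset.mul_sum, Finset.sum_mul]
    rw [Finset.sum_comm]
    refine Finset.sum_congr rfl fun s _ => Finset.sum_congr rfl fun x _ => ?_
    ring
  -- mass
  have swap : ∀ A : Matrix V V ℝ, ∑ z, ∑ x, ν x * A x z = ∑ x, ν x * ∑ z, A x z := by
    intro A
    rw [Finset.sum_comm]
    simp only [Finset.mul_sum]
  have mass : ∀ l, m = ∑ z, ∑ x, ν x * (Q ^ l) x z + ∑ s ∈ Finset.range l, H s := by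
    intro l
    have := Finset.sum_congr (rfl : (Finset.univ : Finset V) = Finset.univ) (fun z _ => dec l z)
    rw [swap, Finset.sum_add_distrib, swap] at this
    simp only [aux_pow_row P hr, aux_mul_row _ P hr, mul_one] at this
    rw [hm, Finset.sum_comm] at this
    simp only [← Finset.mul_sum, aux_pow_row P hr, mul_one] at this
    rw [swap]; exact this
  have hD0 : ∀ l, 0 ≤ ∑ z, ∑ x, ν x * (Q ^ l) x z := fun l =>
    Finset.sum_nonneg fun z _ => Finset.sum_nonneg fun x _ =>
      mul_nonneg (hν x) (aux_pow_nonneg Q hQ0 l _ _)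
  -- bound on H
  have hHb : ∀ s, T ≤ s + 1 → H s ≤ 2 * m * p := by
    intro s hs
    have d := dec s y
    have hn : 0 ≤ ∑ s' ∈ Finset.range s, H s' * (P ^ (s - s')) y y :=
      Finset.sum_nonneg fun s' _ => mul_nonneg (hH0 _) (aux_pow_nonneg P h0 _ _ _)
    have a := aux_avg (fun w => (P ^ (s + 1)) w y) ν m p (p / 4) hν hm (by
      intro x
      have := aux_decay P h0 hr hc p hp hpn T hT 0 (s + 1 - T) x y
      rw [show (0 + 1) * T + (s + 1 - T) = s + 1 by omega] at this
      norm_num at this ⊢; linarith)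
    have a2 := (abs_le.1 a).2
    have : 0 ≤ m * p := by positivity
    simp only [hH] at *
    linarith
  have hTl : T ≤ l := by omega
  constructor
  · have m1 := mass T
    have m2 := mass l
    have hs : m * δ ≤ ∑ z, ∑ x, ν x * (Q ^ T) x z := by
      rw [swap, ← hm, Finset.sum_mul]
      refine Finset.sum_le_sum fun x _ => ?_
      by_cases hxy : x = y
      · rw [hxy, hνy]; simp
      · exact mul_le_mul_of_nonneg_left (hδ x hxy) (hν x)
    have hs2 : ∑ s ∈ Finset.range l, H s ≤ ∑ s ∈ Finset.range T, H s + l * (2 * m * p) := by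
      obtain ⟨d, rfl⟩ := Nat.exists_eq_add_of_le hTl
      rw [Finset.sum_range_add]
      have : ∑ x ∈ Finset.range d, H (T + x) ≤ ∑ x ∈ Finset.range d, 2 * m * p :=
        Finset.sum_le_sum fun i _ => hHb _ (by omega)
      rw [Finset.sum_const, Finset.card_range, nsmul_eq_mul] at this
      have h5 : 0 ≤ (T : ℝ) * (2 * m * p) := by positivity
      push_cast
      linarith
    have : m * (2 * l * p) ≤ m * (δ / 2) := mul_le_mul_of_nonneg_left hl2 hm0
    linarith
  · intro z
    have d := dec l z
    have m2 := mass l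
    set D := ∑ z, ∑ x, ν x * (Q ^ l) x z with hD
    have e : ∑ x, ν x * (Q ^ l * P) x z - p * D
        = (∑ x, ν x * (P ^ (l + 1)) x z - m * p)
          - ∑ s ∈ Finset.range l, H s * ((P ^ (l - s)) y z - p) := by
      simp only [mul_sub, Finset.sum_sub_distrib, ← Finset.sum_mul]
      rw [d]
      linear_combination p * m2
    set q := (l + 1) / T with hq
    have hq2 : 2 ≤ q := by rw [hq, Nat.le_div_iff_mul_le (by omega)]; exact hl
    have hqT : q * T ≤ l + 1 := Nat.div_mul_le_self _ _
    obtain ⟨j, hj⟩ := Nat.exists_eq_add_of_le hq2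
    have hjT : (j + 2) * T = j * T + T + T := by ring
    have hj1T : (j + 1) * T = j * T + T := by ring
    have hj2T : (j + 1 + 1) * T = j * T + T + T := by ring
    have hqj : q * T = j * T + T + T := by rw [hj]; ring
    have a := aux_avg (fun w => (P ^ (l + 1)) w z) ν m p ((1 / 4) ^ q * p) hν hm (by
      intro x
      have := aux_decay P h0 hr hc p hp hpn T hT (j + 1) (l + 1 - q * T) x z
      rw [show (j + 1 + 1) * T + (l + 1 - q * T) = l + 1 by omega] at this
      rw [hj, show 2 + j = j + 1 + 1 by ring]; exact this)
    have b : |∑ s ∈ Finset.range l, H s * ((P ^ (l - s)) y z - p)|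
        ≤ ∑ s ∈ Finset.range l, (H s * (4 * (1 / 4) ^ q * p)
          + 2 * m * p * |(P ^ (l - s)) y z - p|) := by
      refine (Finset.abs_sum_le_sum_abs _ _).trans (Finset.sum_le_sum fun s hs => ?_)
      have hs := Finset.mem_range.1 hs
      rw [abs_mul, abs_of_nonneg (hH0 s)]
      by_cases hsT : T ≤ s + 1
      · have := mul_le_mul_of_nonneg_right (hHb s hsT) (abs_nonneg ((P ^ (l - s)) y z - p))
        have h2 : 0 ≤ H s * (4 * (1 / 4) ^ q * p) := mul_nonneg (hH0 s) (by positivity)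
        linarith
      · have := aux_decay P h0 hr hc p hp hpn T hT j (l - s - (j + 1) * T) y z
        rw [show (j + 1) * T + (l - s - (j + 1) * T) = l - s by omega] at this
        have h3 : (1 / 4 : ℝ) ^ (j + 1) = 4 * (1 / 4) ^ q := by
          rw [hj, show 2 + j = j + 1 + 1 by ring, pow_succ _ (j + 1)]; ring
        rw [h3] at this
        have := mul_le_mul_of_nonneg_left this (hH0 s)
        have h2 : 0 ≤ 2 * m * p * |(P ^ (l - s)) y z - p| := by positivity
        linarith
    rw [Finset.sum_add_distrib, ← Finset.sum_mul, ← Finset.mul_sum] at b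
    have c1 : ∑ s ∈ Finset.range l, |(P ^ (l - s)) y z - p|
        ≤ ∑ r ∈ Finset.range (T + 1), (P ^ r) y z + 2 * (T * p) := by
      refine le_trans ?_ (aux_esum P h0 hr hc p hp hpn T hT1 hT y z (l + 1))
      rw [← Finset.sum_range_reflect, Finset.sum_range_succ']
      refine le_add_of_le_of_nonneg (le_of_eq ?_) (abs_nonneg _)
      refine Finset.sum_congr rfl fun i hi => ?_
      have := Finset.mem_range.1 hi
      rw [show l - (l - 1 - i) = i + 1 by omega]
    have c2 : ∑ s ∈ Finset.range l, H s ≤ m := by linarith [hD0 l]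
    have c3 := mul_le_mul_of_nonneg_right c2 (show 0 ≤ 4 * (1 / 4 : ℝ) ^ q * p by positivity)
    have c4 := mul_le_mul_of_nonneg_left c1 (show 0 ≤ 2 * m * p by positivity)
    rw [e]
    refine (abs_sub _ _).trans ?_
    nlinarith

lemma aux_K_nonneg (G : SimpleGraph V) (x y : V) : 0 ≤ K G x y := by
  unfold K; split_ifs <;> positivity

lemma aux_K_self (G : SimpleGraph V) (x : V) : 1 / 2 ≤ K G x x := by
  unfold K; rw [if_pos rfl]; split_ifs <;> norm_num

lemma aux_K_row (G : SimpleGraph V) (x : V) : ∑ y, K G x y = 1 := by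
  rw [← Finset.add_sum_erase _ _ (Finset.mem_univ x)]
  have : ∑ y ∈ Finset.univ.erase x, K G x y
      = ∑ y ∈ Finset.univ.erase x, if G.Adj x y then 1 / (2 * (deg G x : ℝ)) else 0 := by
    refine Finset.sum_congr rfl fun y hy => ?_
    unfold K
    rw [if_neg (Finset.ne_of_mem_erase hy).symm]
  rw [this, ← Finset.sum_filter, Finset.sum_const]
  have h2 : (Finset.univ.erase x).filter (fun y => G.Adj x y)
      = Finset.univ.filter (fun y => G.Adj x y) := by
    ext y
    simp only [Finset.mem_filter, Finset.mem_erase, Finset.mem_univ, and_true, true_and]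
    exact ⟨fun h => h.2, fun h => ⟨h.ne', h⟩⟩
  rw [h2]
  change K G x x + deg G x • _ = _
  unfold K
  rw [if_pos rfl]
  split_ifs with h
  · simp [h]
  · have : (deg G x : ℝ) ≠ 0 := by exact_mod_cast h
    rw [nsmul_eq_mul]; field_simp; norm_num

lemma aux_deg_eq (G : SimpleGraph V) (hv : IsVertexTransitive G) (x y : V) :
    deg G x = deg G y := by
  obtain ⟨e, rfl⟩ := hv x y
  unfold deg
  refine Finset.card_bij (fun a _ => e a) ?_ ?_ ?_
  · intro a ha
    simp only [Finset.mem_filter, Finset.mem_univ, true_and] at ha ⊢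
    exact e.map_rel_iff.2 ha
  · intro a _ b _ h; exact e.injective h
  · intro b hb
    simp only [Finset.mem_filter, Finset.mem_univ, true_and] at hb
    refine ⟨e.symm b, ?_, by simp⟩
    simp only [Finset.mem_filter, Finset.mem_univ, true_and]
    rw [← e.map_rel_iff]; simpa using hb

lemma aux_K_symm (G : SimpleGraph V) (hv : IsVertexTransitive G) (x y : V) :
    K G x y = K G y x := by
  unfold K
  rw [aux_deg_eq G hv x y, G.adj_comm x y]
  by_cases h : x = y
  · rw [if_pos h, if_pos h.symm]
  · rw [if_neg h, if_neg (Ne.symm h)]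

lemma aux_K_col (G : SimpleGraph V) (hv : IsVertexTransitive G) (y : V) : ∑ x, K G x y = 1 := by
  simp only [aux_K_symm G hv _ y]; exact aux_K_row G y

lemma aux_Kpow (G : SimpleGraph V) (t : ℕ) :
    ∀ x y, Kpow G t x y = ((Matrix.of (K G) : Matrix V V ℝ) ^ t) x y := by
  induction t with
  | zero => intro x y; rw [pow_zero, Matrix.one_apply]; rfl
  | succ t ih =>
    intro x y
    rw [pow_succ, Matrix.mul_apply]
    simp only [Kpow, ih, Matrix.of_apply]

lemma aux_KkillPow (G : SimpleGraph V) (S : Finset V) (t : ℕ) :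
    ∀ x y, KkillPow G S t x y = ((Matrix.of (Kkill G S) : Matrix V V ℝ) ^ t) x y := by
  induction t with
  | zero => intro x y; rw [pow_zero, Matrix.one_apply]; rfl
  | succ t ih =>
    intro x y
    rw [pow_succ, Matrix.mul_apply]
    simp only [KkillPow, ih, Matrix.of_apply]

lemma aux_Kkill_nonneg (G : SimpleGraph V) (S : Finset V) (x y : V) : 0 ≤ Kkill G S x y := by
  unfold Kkill; split_ifs; exacts [le_rfl, aux_K_nonneg _ _ _]

lemma aux_KkillPow_nonneg (G : SimpleGraph V) (S : Finset V) (t : ℕ) (x y : V) :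
    0 ≤ KkillPow G S t x y := by
  rw [aux_KkillPow]
  exact aux_pow_nonneg _ (fun x y => aux_Kkill_nonneg G S x y) _ _ _

lemma aux_KkillPow_mono (G : SimpleGraph V) (S S' : Finset V) (h : S ⊆ S') (t : ℕ) :
    ∀ x y, KkillPow G S' t x y ≤ KkillPow G S t x y := by
  induction t with
  | zero => intro x y; exact le_rfl
  | succ t ih =>
    intro x y
    simp only [KkillPow]
    refine Finset.sum_le_sum fun z _ => ?_
    refine mul_le_mul (ih _ _) ?_ (aux_Kkill_nonneg _ _ _ _) (aux_KkillPow_nonneg _ _ _ _ _)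
    unfold Kkill
    have := aux_K_nonneg G z y
    by_cases h1 : y ∈ S
    · rw [if_pos h1, if_pos (h h1)]
    · rw [if_neg h1]; split_ifs <;> linarith

lemma aux_KkillPow_self (G : SimpleGraph V) (x y : V) (hxy : x ≠ y) (t : ℕ) :
    0 < KkillPow G {y} t x x := by
  induction t with
  | zero => simp [KkillPow]
  | succ t ih =>
    simp only [KkillPow]
    refine lt_of_lt_of_le ?_ (Finset.single_le_sum (f := fun z => KkillPow G {y} t x z * Kkill G {y} z x)
      (fun z _ => mul_nonneg (aux_KkillPow_nonneg _ _ _ _ _) (aux_Kkill_nonneg _ _ _ _))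
      (Finset.mem_univ x))
    refine mul_pos ih ?_
    unfold Kkill
    rw [if_neg (by simpa using hxy)]
    linarith [aux_K_self G x]

lemma aux_KkillPow_y (G : SimpleGraph V) (x y : V) (hxy : x ≠ y) (t : ℕ) :
    KkillPow G {y} t x y = 0 := by
  cases t with
  | zero => simp [KkillPow, hxy]
  | succ t => simp [KkillPow, Kkill]

/-- mixing -/
lemma aux_mix (G : SimpleGraph V) (hc : G.Connected) (hv : IsVertexTransitive G) :
    ∃ t : ℕ, ∀ x y : V, |Kpow G t x y / unif V - 1| ≤ 1 / 4 := by
  haveI := hc.nonempty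
  set P : Matrix V V ℝ := Matrix.of (K G) with hP
  have h0 : ∀ x y, 0 ≤ P x y := fun x y => aux_K_nonneg G x y
  have hr : ∀ x, ∑ y, P x y = 1 := fun x => aux_K_row G x
  have hcol : ∀ y, ∑ x, P x y = 1 := fun y => aux_K_col G hv y
  have step : ∀ t x y w, 0 < (P ^ t) x y → 0 < P y w → 0 < (P ^ (t + 1)) x w := by
    intro t x y w h1 h2
    rw [pow_succ, Matrix.mul_apply]
    exact lt_of_lt_of_le (mul_pos h1 h2)
      (Finset.single_le_sum (f := fun z => (P ^ t) x z * P z w)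
        (fun z _ => mul_nonneg (aux_pow_nonneg P h0 _ _ _) (h0 _ _)) (Finset.mem_univ y))
  have hself : ∀ x, 0 < P x x := fun x => by
    have := aux_K_self G x
    change 0 < K G x x
    linarith
  have hadj : ∀ x y, G.Adj x y → 0 < P x y := by
    intro x y h
    change 0 < K G x y
    unfold K
    rw [if_neg h.ne, if_pos h]
    have : 0 < deg G x := Finset.card_pos.2 ⟨y, by simpa using h⟩
    have : (0 : ℝ) < deg G x := by exact_mod_cast this
    positivity
  have hex : ∀ x y, ∃ t, 0 < (P ^ t) x y := by
    intro x y
    obtain ⟨w⟩ := hc.preconnected y x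
    induction w with
    | nil => exact ⟨0, by simp⟩
    | cons h _ ih =>
      obtain ⟨t, ht⟩ := ih
      exact ⟨t + 1, step t _ _ _ ht (hadj _ _ h.symm)⟩
  have hev : ∀ᶠ t : ℕ in atTop, ∀ x y, 0 < (P ^ t) x y := by
    rw [eventually_all]; intro x
    rw [eventually_all]; intro y
    obtain ⟨t, ht⟩ := hex x y
    filter_upwards [eventually_ge_atTop t] with s hs
    induction s, hs using Nat.le_induction with
    | base => exact ht
    | succ s _ ih => exact step s x y y ih (hself y)
  obtain ⟨N, hN⟩ := hev.exists
  have hn : (0 : ℝ) < Fintype.card V := by exact_mod_cast Fintype.card_pos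
  obtain ⟨ε, hε, hεN⟩ : ∃ ε : ℝ, 0 < ε ∧ ∀ x y, ε ≤ (P ^ N) x y := by
    obtain ⟨a, ha⟩ := Finite.exists_min (fun q : V × V => (P ^ N) q.1 q.2)
    exact ⟨_, hN a.1 a.2, fun x y => ha (x, y)⟩
  set p : ℝ := unif V with hp
  have hpn : (Fintype.card V : ℝ) * p = 1 := mul_inv_cancel₀ hn.ne'
  have hppos : 0 < p := inv_pos.2 hn
  set θ : ℝ := 1 - Fintype.card V * ε with hθ
  have hθ0 : 0 ≤ θ := by
    obtain ⟨x⟩ := hc.nonempty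
    have := Finset.sum_le_sum (s := Finset.univ) (fun y _ => hεN x y)
    rw [aux_pow_row P hr] at this
    simp at this; linarith
  have hθ1 : θ < 1 := by have := mul_pos hn hε; linarith
  have key : ∀ j : ℕ, ∀ x z, |(P ^ (j * N)) x z - p| ≤ θ ^ j * (1 + p) := by
    intro j
    induction j with
    | zero =>
      intro x z
      rw [zero_mul, pow_zero, Matrix.one_apply, abs_le]
      split_ifs <;> constructor <;> simp <;> linarith
    | succ j ih =>
      intro x z
      have e : (P ^ ((j + 1) * N)) x z - p
          = ∑ w, ((P ^ N) x w - ε) * ((P ^ (j * N)) w z - p) := by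
        rw [show (j + 1) * N = N + j * N by ring, pow_add, Matrix.mul_apply]
        have a := aux_pow_row P hr N x
        have b := aux_pow_col P hcol (j * N) z
        simp only [sub_mul, mul_sub, Finset.sum_sub_distrib, ← Finset.mul_sum, ← Finset.sum_mul]
        rw [a, b]
        simp only [Finset.sum_const, Finset.card_univ, nsmul_eq_mul]
        linear_combination (-ε) * hpn
      rw [e]
      refine (Finset.abs_sum_le_sum_abs _ _).trans ?_
      calc ∑ w, |((P ^ N) x w - ε) * ((P ^ (j * N)) w z - p)|
          ≤ ∑ w : V, ((P ^ N) x w - ε) * (θ ^ j * (1 + p)) := by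
            refine Finset.sum_le_sum fun w _ => ?_
            rw [abs_mul, abs_of_nonneg (sub_nonneg.2 (hεN x w))]
            exact mul_le_mul_of_nonneg_left (ih w z) (sub_nonneg.2 (hεN x w))
        _ = θ ^ (j + 1) * (1 + p) := by
            rw [← Finset.sum_mul, Finset.sum_sub_distrib, aux_pow_row P hr]
            simp only [Finset.sum_const, Finset.card_univ, nsmul_eq_mul]
            rw [← hθ]; ring
  have hlim : Tendsto (fun j : ℕ => θ ^ j * (1 + p)) atTop (nhds (0 * (1 + p))) :=
    (tendsto_pow_atTop_nhds_zero_of_lt_one hθ0 hθ1).mul_const _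
  rw [zero_mul] at hlim
  obtain ⟨j, hj⟩ := (hlim.eventually (gt_mem_nhds (show 0 < p / 4 by positivity))).exists
  refine ⟨j * N, fun x y => ?_⟩
  rw [aux_Kpow]
  have h1 := (key j x y).trans hj.le
  rw [show ((P ^ (j * N)) x y / p - 1) = ((P ^ (j * N)) x y - p) / p by field_simp,
    abs_div, abs_of_pos hppos, div_le_iff₀ hppos]
  linarith

lemma aux_Tmix_pos (G : SimpleGraph V) (hc : G.Connected) (hv : IsVertexTransitive G)
    (x y : V) (hxy : x ≠ y) : 1 ≤ Tmix G := by
  by_contra h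
  have h0 : Tmix G = 0 := by omega
  have hmem : ∀ x y : V, |Kpow G (Tmix G) x y / unif V - 1| ≤ 1 / 4 :=
    Nat.sInf_mem (s := {t : ℕ | ∀ x y : V, |Kpow G t x y / unif V - 1| ≤ 1 / 4}) (aux_mix G hc hv)
  have := hmem x y
  rw [h0] at this
  simp [Kpow, hxy] at this
  norm_num at this

set_option maxHeartbeats 2000000 in
/-- one graph version -/
lemma aux_graph (G : SimpleGraph V) (hc : G.Connected) (hv : IsVertexTransitive G) (δ : ℝ)
    (hδ0 : 0 < δ) (hδ1 : δ ≤ 1)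
    (hδ : ∀ x y z : V, x ≠ y → x ≠ z → y ≠ z → hitBy G {y, z} x (Tmix G) ≤ 1 - δ)
    (k : ℕ) (hk : 1 ≤ k) (hkp : (k : ℝ) * (Tmix G : ℝ) / (Fintype.card V : ℝ) ≤ δ / 8)
    (c : ℝ) (hc2 : 2 ≤ c) (x y z : V) (hxy : x ≠ y) :
    |condAtProb G y x z ⌊c * ((k * Tmix G : ℕ) : ℝ)⌋₊ - unif V|
          ≤ (400 / δ ^ 2) * (Real.exp (-1 * c * k)
                + (k : ℝ) * (Tmix G : ℝ) / (Fintype.card V : ℝ)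
                + green G y z) * unif V := by
  have hT1 := aux_Tmix_pos G hc hv x y hxy
  have hmem : ∀ x y : V, |Kpow G (Tmix G) x y / unif V - 1| ≤ 1 / 4 :=
    Nat.sInf_mem (s := {t : ℕ | ∀ x y : V, |Kpow G t x y / unif V - 1| ≤ 1 / 4}) (aux_mix G hc hv)
  unfold green
  set T := Tmix G with hTdef
  set P : Matrix V V ℝ := Matrix.of (K G) with hP
  set Q : Matrix V V ℝ := Matrix.of (Kkill G {y}) with hQ
  have hn : (0 : ℝ) < Fintype.card V := by exact_mod_cast Fintype.card_pos_iff.2 ⟨x⟩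
  set p : ℝ := unif V with hp
  have hpn : (Fintype.card V : ℝ) * p = 1 := mul_inv_cancel₀ hn.ne'
  have hppos : 0 < p := inv_pos.2 hn
  have hdiv : (k : ℝ) * (T : ℝ) / (Fintype.card V : ℝ) = k * (T * p) := by
    rw [hp, unif]; ring
  rw [hdiv] at hkp ⊢
  have hk1 : (1 : ℝ) ≤ k := by exact_mod_cast hk
  have hT1' : (1 : ℝ) ≤ T := by exact_mod_cast hT1
  set U : ℝ := T * p with hU
  have hU0 : 0 < U := by positivity
  have hUk : U ≤ k * U := le_mul_of_one_le_left hU0.le hk1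
  have hU8 : U ≤ δ / 8 := hUk.trans hkp
  have hPT : ∀ x z, |(P ^ T) x z - p| ≤ p / 4 := by
    intro x z
    have := hmem x z
    rw [aux_Kpow, ← hP, show ((P ^ T) x z / p - 1) = ((P ^ T) x z - p) / p by field_simp,
      abs_div, abs_of_pos hppos, div_le_iff₀ hppos] at this
    linarith
  have hQT : ∀ x, x ≠ y → δ ≤ ∑ z, (Q ^ T) x z := by
    intro x hx
    obtain ⟨z, hz⟩ : ∃ z, z ∉ ({x, y} : Finset V) := by
      by_contra! hcon
      have h1 : Fintype.card V ≤ 2 := by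
        rw [← Finset.card_univ]
        exact (Finset.card_le_card (fun v _ => hcon v)).trans Finset.card_le_two
      have h2 : (Fintype.card V : ℝ) ≤ 2 := by exact_mod_cast h1
      have h3 : p ≤ U := le_mul_of_one_le_left hppos.le hT1'
      nlinarith
    simp only [Finset.mem_insert, Finset.mem_singleton, not_or] at hz
    have h1 := hδ x y z hx (Ne.symm hz.1) (Ne.symm hz.2)
    unfold hitBy at h1
    rw [if_neg (by simp [hx, Ne.symm hz.1])] at h1
    have h2 : ∑ w, KkillPow G {y, z} T x w ≤ ∑ w, KkillPow G {y} T x w :=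
      Finset.sum_le_sum fun w _ => aux_KkillPow_mono G _ _ (by simp) T x w
    simp only [aux_KkillPow G {y}, ← hQ] at h2
    linarith
  set t := ⌊c * ((k * T : ℕ) : ℝ)⌋₊ with ht
  have hckT : (2 * T : ℝ) ≤ c * ((k * T : ℕ) : ℝ) := by
    push_cast
    have : (T : ℝ) ≤ k * T := le_mul_of_one_le_left (by positivity) hk1
    nlinarith
  have ht2 : 2 * T ≤ t := Nat.le_floor (by push_cast; push_cast at hckT; exact hckT)
  set M := ⌊δ / (4 * U)⌋₊ with hM
  have hδU : 2 ≤ δ / (4 * U) := by rw [le_div_iff₀ (by positivity)]; linarith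
  have hM2 : 2 ≤ M := Nat.le_floor (by exact_mod_cast hδU)
  have hMle : (M : ℝ) * (4 * U) ≤ δ := by
    rw [← le_div_iff₀ (by positivity)]; exact Nat.floor_le (by positivity)
  have hMlt : δ < (M + 1 : ℝ) * (4 * U) := by
    rw [← div_lt_iff₀ (by positivity)]; exact Nat.lt_floor_add_one _
  have hM2' : (2 : ℝ) ≤ M := by exact_mod_cast hM2
  obtain ⟨l, hl⟩ : ∃ l, l + 1 = min t (M * T) := by
    refine ⟨min t (M * T) - 1, Nat.sub_add_cancel (le_min (by omega) ?_)⟩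
    nlinarith
  have hlM : l + 1 ≤ M * T := hl ▸ min_le_right _ _
  have hlt : l + 1 ≤ t := hl ▸ min_le_left _ _
  have hl2T : 2 * T ≤ l + 1 := hl ▸ le_min ht2 (Nat.mul_le_mul_right T hM2)
  have hl2 : 2 * (l : ℝ) * p ≤ δ / 2 := by
    have : (l : ℝ) + 1 ≤ M * T := by exact_mod_cast hlM
    have h2 : (l : ℝ) * p ≤ M * T * p := mul_le_mul_of_nonneg_right (by linarith) hppos.le
    have h3 : (M : ℝ) * T * p = M * U := by rw [hU]; ring
    linarith
  set ν : V → ℝ := fun v => KkillPow G {y} (t - (l + 1)) x v with hν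
  have hν0 : ∀ v, 0 ≤ ν v := fun v => aux_KkillPow_nonneg _ _ _ _ _
  set m := ∑ v, ν v with hm
  have hmpos : 0 < m := lt_of_lt_of_le (aux_KkillPow_self G x y hxy _)
    (Finset.single_le_sum (f := ν) (fun v _ => hν0 v) (Finset.mem_univ x))
  obtain ⟨hD, hB⟩ := aux_main P Q y
    (by intro w v; simp only [hQ, hP, Matrix.of_apply, Kkill, Finset.mem_singleton])
    (fun x y => aux_K_nonneg G x y) (fun x => aux_K_row G x) (fun y => aux_K_col G hv y)
    p hppos hpn T hT1 hPT δ hQT ν hν0 (aux_KkillPow_y G x y hxy _) m rfl l hl2T hl2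
  have hB := hB z
  -- identify
  have hpowx : ∀ w, KkillPow G {y} (t - 1) x w = ∑ v, ν v * (Q ^ l) v w := by
    intro w
    rw [aux_KkillPow, show t - 1 = (t - (l + 1)) + l by omega, pow_add, Matrix.mul_apply]
    simp only [hν, aux_KkillPow, hQ]
  have hcond : condAtProb G y x z t
      = (∑ v, ν v * (Q ^ l * P) v z) / (∑ z, ∑ x, ν x * (Q ^ l) x z) := by
    unfold condAtProb
    simp only [hpowx]
    congr 1
    simp only [Matrix.mul_apply, Finset.mul_sum, Finset.sum_mul]
    rw [Finset.sum_comm]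
    refine Finset.sum_congr rfl fun v _ => Finset.sum_congr rfl fun w _ => ?_
    rw [hP, Matrix.of_apply]; ring
  set D := ∑ z, ∑ x, ν x * (Q ^ l) x z with hDdef
  set B := ∑ v, ν v * (Q ^ l * P) v z with hBdef
  simp only [aux_Kpow G, ← hP]
  set g := ∑ r ∈ Finset.range (T + 1), (P ^ r) y z with hg
  have hg0 : 0 ≤ g := Finset.sum_nonneg fun r _ =>
    aux_pow_nonneg P (fun x y => aux_K_nonneg G x y) _ _ _
  have hDpos : 0 < D := lt_of_lt_of_le (by positivity) hD
  -- exponential bound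
  have hexp : (1 / 4 : ℝ) ^ ((l + 1) / T) ≤ 16 * Real.exp (-1 * c * k) + 8 * U / δ := by
    have h14 : ∀ j : ℕ, (1 / 4 : ℝ) ^ j ≤ Real.exp (-j) := by
      intro j
      rw [show -(j : ℝ) = j * (-1) by ring, Real.exp_nat_mul]
      refine pow_le_pow_left₀ (by norm_num) ?_ _
      rw [Real.exp_neg, one_div]
      exact inv_anti₀ (Real.exp_pos _) (by linarith [Real.exp_one_lt_d9])
    have hE := Real.exp_pos (-1 * c * k)
    rcases le_total t (M * T) with h | h
    · rw [hl, min_eq_left h]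
      have hj : c * k ≤ ((t / T : ℕ) : ℝ) + 2 := by
        have h1 : c * ((k * T : ℕ) : ℝ) < t + 1 := Nat.lt_floor_add_one _
        have h2 : t < (t / T + 1) * T := by
          have := Nat.lt_div_mul_add (a := t) (b := T) (by omega)
          linarith
        have h3 : t + 1 ≤ (t / T + 1) * T := h2
        have h4 : (t : ℝ) + 1 ≤ (((t / T : ℕ) : ℝ) + 1) * T := by exact_mod_cast h3
        push_cast at h1
        have h5 : c * k * T < (((t / T : ℕ) : ℝ) + 1) * T := by linarith
        have := lt_of_mul_lt_mul_right h5 (by positivity)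
        linarith
      have h6 := h14 (t / T)
      have h7 : Real.exp (-((t / T : ℕ) : ℝ)) ≤ Real.exp 2 * Real.exp (-1 * c * k) := by
        rw [← Real.exp_add]; exact Real.exp_le_exp.2 (by linarith)
      have h8 : Real.exp 2 ≤ 16 := by
        rw [show (2 : ℝ) = 1 + 1 by norm_num, Real.exp_add]
        nlinarith [Real.exp_one_lt_d9, Real.exp_pos 1]
      have h9 : 0 ≤ 8 * U / δ := by positivity
      have h10 := mul_le_mul_of_nonneg_right h8 hE.le
      linarith
    · rw [hl, min_eq_right h, Nat.mul_div_cancel _ (by omega)]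
      have h6 := h14 M
      have h7 : Real.exp (-(M : ℝ)) ≤ 1 / M := by
        rw [Real.exp_neg, one_div]
        exact inv_anti₀ (by linarith) (by linarith [Real.add_one_le_exp (M : ℝ)])
      have h8 : 1 / (M : ℝ) ≤ 8 * U / δ := by
        rw [div_le_div_iff₀ (by linarith) hδ0]
        nlinarith
      linarith
  rw [hcond, show B / D - p = (B - p * D) / D by field_simp, abs_div, abs_of_pos hDpos,
    div_le_iff₀ hDpos]
  set E := Real.exp (-1 * c * k) with hE
  have hE0 : 0 < E := Real.exp_pos _
  have hS0 : 0 ≤ E + k * U + g := by positivity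
  have h1 : 5 * (1 / 4 : ℝ) ^ ((l + 1) / T) + 4 * U + 2 * g ≤ 200 / δ * (E + k * U + g) := by
    have a : 80 * E ≤ 200 / δ * E := by
      refine mul_le_mul_of_nonneg_right ?_ hE0.le
      rw [le_div_iff₀ hδ0]; linarith
    have b : 40 * U / δ + 4 * U ≤ 200 / δ * (k * U) := by
      have : 200 / δ * U ≤ 200 / δ * (k * U) := mul_le_mul_of_nonneg_left hUk (by positivity)
      refine le_trans ?_ this
      have : 4 * U ≤ 4 * U / δ := by
        rw [le_div_iff₀ hδ0]; nlinarith
      have e : 200 / δ * U = 40 * U / δ + 4 * U / δ + 156 * U / δ := by ring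
      have : 0 ≤ 156 * U / δ := by positivity
      linarith
    have c' : 2 * g ≤ 200 / δ * g := by
      refine mul_le_mul_of_nonneg_right ?_ hg0
      rw [le_div_iff₀ hδ0]; linarith
    have : 5 * (8 * U / δ) = 40 * U / δ := by ring
    have e2 : 200 / δ * (E + k * U + g) = 200 / δ * E + 200 / δ * (k * U) + 200 / δ * g := by ring
    linarith
  calc |B - p * D| ≤ m * p * (5 * (1 / 4) ^ ((l + 1) / T) + 4 * U + 2 * g) := hB
    _ ≤ m * p * (200 / δ * (E + k * U + g)) := mul_le_mul_of_nonneg_left h1 (by positivity)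
    _ = (400 / δ ^ 2) * (E + k * U + g) * p * (m * δ / 2) := by field_simp; norm_num
    _ ≤ (400 / δ ^ 2) * (E + k * U + g) * p * D :=
        mul_le_mul_of_nonneg_left hD (by positivity)

/-- Lemma 8. Under Assumption 1 there are constants
`γ, p₀, C > 0` so that for `k ≥ 1` with `k Υ_n ≤ p₀`, `c ≥ 2` and `x ≠ y`,
`|P_x[X(c T_k) = z | τ(y) ≥ c T_k] - π(z)| ≤ C (e^{-γck} + kΥ_n + g(y,z)) π(z)`. -/
theorem condition_not_hit_rn
    (V : ℕ → Type) [∀ n, Fintype (V n)] (G : ∀ n, SimpleGraph (V n))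
    (hA : Assumption1 V G) :
    ∃ γ > (0 : ℝ), ∃ p₀ > (0 : ℝ), ∃ C > (0 : ℝ), ∀ n, ∀ k : ℕ, 1 ≤ k →
      (k : ℝ) * (Tmix (G n) : ℝ) / (Fintype.card (V n) : ℝ) ≤ p₀ →
      ∀ c : ℝ, 2 ≤ c → ∀ x y z : V n, x ≠ y →
        |condAtProb (G n) y x z ⌊c * ((k * Tmix (G n) : ℕ) : ℝ)⌋₊ - unif (V n)|
          ≤ C * (Real.exp (-γ * c * k)
                + (k : ℝ) * (Tmix (G n) : ℝ) / (Fintype.card (V n) : ℝ)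
                + green (G n) y z) * unif (V n) := by
  obtain ⟨ρ, hρ, hmiss⟩ := hA.hit_miss
  have hδ0 : 0 < 1 - max ρ 0 := sub_pos.2 (max_lt hρ one_pos)
  refine ⟨1, one_pos, (1 - max ρ 0) / 8, by positivity, 400 / (1 - max ρ 0) ^ 2, by positivity, ?_⟩
  intro n k hk hkp c hc x y z hxy
  exact aux_graph (G n) (hA.conn n) (hA.vt n) (1 - max ρ 0) hδ0 (by linarith [le_max_right ρ 0])
    (fun x y z h1 h2 h3 => (hmiss n x y z h1 h2 h3).trans (by linarith [le_max_left ρ 0]))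
    k hk hkp c hc x y z hxy

end RWPaint
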